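/- arXiv:2003.09673 — 2 statements merged into one kernel-verified Lean document; each statement's English description precedes it below -/
import Mathlib

section
/- Let D, d, d_e be positive integers with d_e ≤ d ≤ D. Let U ∈ ℝ^{D×d_e} have orthonormal columns, let z* ∈ ℝ^{d_e} be nonzero, and set x_T* = U z*. For a D×d matrix A define y₂*(A) = Bᵀ (B Bᵀ)⁻¹ z* where B = Uᵀ A (defined for the almost-every A for which B Bᵀ is invertible, with an arbitrary value otherwise). Then for every δ > 0, the Gaussian-matrix-measure of the set {A : ‖y₂*(A)‖₂ ≤ δ} equals the probability that a chi-squared random variable with d − d_e + 1 degrees of freedom is at least ‖x_T*‖₂² / δ². -/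
open MeasureTheory ProbabilityTheory Matrix

noncomputable def gaussMatrix (D d : ℕ) : Measure (Fin D → Fin d → ℝ) :=
  Measure.pi fun _ : Fin D => Measure.pi fun _ : Fin d => gaussianReal 0 1

noncomputable def chiSq (n : ℕ) : Measure ℝ := gammaMeasure (n / 2) (1 / 2)

theorem ext_of_mgf_eqOn_Iio {μ ν : Measure ℝ} [IsProbabilityMeasure μ] [IsProbabilityMeasure ν]
    {r : ℝ} (hr : 0 < r) (hpos : ∀ t < r, 0 < mgf id ν t)
    (h : ∀ t < r, mgf id μ t = mgf id ν t) : μ = ν := by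
  have hsub : ∀ (ρ : Measure ℝ) [IsProbabilityMeasure ρ], (∀ t < r, 0 < mgf id ρ t) →
      AnalyticOnNhd ℂ (complexMGF id ρ) {z | z.re ∈ Set.Iio r} := by
    intro ρ _ hρ
    refine analyticOnNhd_complexMGF.mono fun z hz => ?_
    exact interior_maximal (fun t ht => mgf_pos_iff.1 (hρ t ht)) isOpen_Iio hz
  have hμ := hsub μ fun t ht => by rw [h t ht]; exact hpos t ht
  have hν := hsub ν hpos
  have heq : Set.EqOn (complexMGF id μ) (complexMGF id ν) {z | z.re ∈ Set.Iio r} := by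
    refine hμ.eqOn_of_preconnected_of_frequently_eq hν
      ((convex_Iio r).linear_preimage Complex.reLm).isPreconnected
      (z₀ := ((0 : ℝ) : ℂ)) (by simpa using hr) ?_
    have hreal : ∃ᶠ x : ℝ in nhdsWithin 0 {0}ᶜ, complexMGF id μ x = complexMGF id ν x := by
      refine Filter.Eventually.frequently ?_
      filter_upwards [nhdsWithin_le_nhds (Iio_mem_nhds hr)] with y hy
      rw [complexMGF_ofReal, complexMGF_ofReal, h y hy]
    refine Filter.Tendsto.frequently (f := Complex.ofReal)
      (p := fun z => complexMGF id μ z = complexMGF id ν z) ?_ hreal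
    refine tendsto_nhdsWithin_iff.2 ⟨(Complex.continuous_ofReal.tendsto 0).mono_left
      nhdsWithin_le_nhds, ?_⟩
    filter_upwards [self_mem_nhdsWithin] with y hy
    simpa using hy
  refine Measure.ext_of_charFun (funext fun t => ?_)
  rw [← complexMGF_id_mul_I, ← complexMGF_id_mul_I]
  exact heq (by simpa using hr)

theorem mgf_id_gammaMeasure {a r t : ℝ} (ha : 0 < a) (hr : 0 < r) (ht : t < r) :
    mgf id (gammaMeasure a r) t = (r / (r - t)) ^ a := by
  have hrt : 0 < r - t := sub_pos.2 ht
  rw [mgf, gammaMeasure, integral_withDensity_eq_integral_toReal_smul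
    (by unfold gammaPDF; fun_prop) (by simp [gammaPDF])]
  calc ∫ x, (gammaPDF a r x).toReal • Real.exp (t * id x)
      = ∫ x, (Set.Ici (0 : ℝ)).indicator (fun x => r ^ a / Real.Gamma a *
          (x ^ (a - 1) * Real.exp (-((r - t) * x)))) x := by
        refine integral_congr_ae (Filter.Eventually.of_forall fun x => ?_)
        simp only [gammaPDF, Set.indicator_apply, Set.mem_Ici, id, smul_eq_mul]
        rw [ENNReal.toReal_ofReal (gammaPDFReal_nonneg ha hr x), gammaPDFReal]
        split_ifs
        · rw [mul_assoc, mul_assoc, ← Real.exp_add]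
          congr 3
          ring
        · simp
    _ = (r / (r - t)) ^ a := by
        rw [integral_indicator measurableSet_Ici, integral_Ici_eq_integral_Ioi, integral_const_mul,
          Real.integral_rpow_mul_exp_neg_mul_Ioi ha hrt, Real.div_rpow zero_le_one hrt.le,
          Real.div_rpow hr.le hrt.le, Real.one_rpow]
        have := (Real.Gamma_pos_of_pos ha).ne'
        field_simp

theorem integral_exp_mul_sq_gaussianReal {t : ℝ} (ht : t < 1 / 2) :
    ∫ x, Real.exp (t * x ^ 2) ∂gaussianReal 0 1 = √(1 / 2 / (1 / 2 - t)) := by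
  rw [integral_gaussianReal_eq_integral_smul one_ne_zero]
  have : ∀ x : ℝ, gaussianPDFReal 0 1 x • Real.exp (t * x ^ 2)
      = (√(2 * Real.pi))⁻¹ * Real.exp (-(1 / 2 - t) * x ^ 2) := fun x => by
    simp only [gaussianPDFReal, NNReal.coe_one, mul_one, sub_zero, smul_eq_mul]
    rw [mul_assoc, ← Real.exp_add]
    congr 2
    ring
  simp_rw [this]
  rw [integral_const_mul, integral_gaussian, ← Real.sqrt_inv, ← Real.sqrt_mul (by positivity)]
  congr 1
  have : 1 / 2 - t ≠ 0 := by linarith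
  have := Real.pi_ne_zero
  field_simp

theorem map_norm_sq_stdGaussian {E : Type*} [NormedAddCommGroup E] [InnerProductSpace ℝ E]
    [FiniteDimensional ℝ E] [MeasurableSpace E] [BorelSpace E] {n : ℕ}
    (hE : Module.finrank ℝ E = n) (hn : 0 < n) :
    (stdGaussian E).map (fun x => ‖x‖ ^ 2) = gammaMeasure (n / 2) (1 / 2) := by
  have hn2 : (0 : ℝ) < n / 2 := by positivity
  have := isProbabilityMeasure_gammaMeasure hn2 (r := 1 / 2) (by norm_num)
  have : IsProbabilityMeasure ((stdGaussian E).map (fun x => ‖x‖ ^ 2)) :=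
    Measure.isProbabilityMeasure_map (by fun_prop)
  refine ext_of_mgf_eqOn_Iio (r := 1 / 2) (by norm_num) (fun t ht => ?_) fun t ht => ?_
  · rw [mgf_id_gammaMeasure hn2 (by norm_num) ht]
    have : 0 < 1 / 2 - t := by linarith
    positivity
  rw [mgf_id_gammaMeasure hn2 (by norm_num) ht, mgf, integral_map (by fun_prop) (by fun_prop),
    stdGaussian, integral_map (Measurable.aemeasurable (by fun_prop))
      (Measurable.aestronglyMeasurable (by fun_prop))]
  have hnorm : ∀ x : Fin (Module.finrank ℝ E) → ℝ,
      ‖∑ i, x i • stdOrthonormalBasis ℝ E i‖ ^ 2 = ∑ i, x i ^ 2 := fun x => by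
    rw [← (stdOrthonormalBasis ℝ E).sum_sq_norm_inner_right]
    simp [inner_sum, inner_smul_right, (stdOrthonormalBasis ℝ E).inner_eq_ite]
  simp only [id, hnorm, Finset.mul_sum, Real.exp_sum]
  rw [integral_fintype_prod_eq_pow (fun x : ℝ => Real.exp (t * x ^ 2)),
    integral_exp_mul_sq_gaussianReal ht, Fintype.card_fin, hE, Real.sqrt_eq_rpow,
    ← Real.rpow_mul_natCast (div_nonneg (by norm_num) (by linarith))]
  congr 1
  ring

theorem stdGaussian_map_of_norm_adjoint {E F : Type*}
    [NormedAddCommGroup E] [InnerProductSpace ℝ E] [FiniteDimensional ℝ E] [MeasurableSpace E]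
    [BorelSpace E] [NormedAddCommGroup F] [InnerProductSpace ℝ F] [FiniteDimensional ℝ F]
    [MeasurableSpace F] [BorelSpace F] (L : E →L[ℝ] F) (hL : ∀ y, ‖L.adjoint y‖ = ‖y‖) :
    (stdGaussian E).map L = stdGaussian F := by
  have : IsProbabilityMeasure ((stdGaussian E).map L) :=
    Measure.isProbabilityMeasure_map (by fun_prop)
  refine Measure.ext_of_charFun (funext fun t => ?_)
  rw [charFun_stdGaussian, ← hL t, ← charFun_stdGaussian, charFun_apply, charFun_apply,
    integral_map (by fun_prop) (by fun_prop)]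
  simp [ContinuousLinearMap.adjoint_inner_right]

theorem pi_stdGaussian_map_sum_smul {E : Type*} [NormedAddCommGroup E] [InnerProductSpace ℝ E]
    [FiniteDimensional ℝ E] [MeasurableSpace E] [BorelSpace E] {ι κ : Type*} [Fintype ι]
    [Fintype κ] [DecidableEq κ] (W : Matrix ι κ ℝ) (hW : Wᵀ * W = 1) :
    (Measure.pi fun _ : ι => stdGaussian E).map (fun X j => ∑ i, W i j • X i)
      = Measure.pi fun _ : κ => stdGaussian E := by
  have hmeas : Measurable fun (X : ι → E) j => ∑ i, W i j • X i := by fun_prop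
  have : IsProbabilityMeasure ((Measure.pi fun _ : ι => stdGaussian E).map
      (fun X j => ∑ i, W i j • X i)) := Measure.isProbabilityMeasure_map hmeas.aemeasurable
  rw [← charFun_eq_pi_iff]
  intro t
  let s : PiLp 2 fun _ : ι => E := WithLp.toLp 2 fun i => ∑ j, W i j • t j
  have hs : ∑ i, ‖s i‖ ^ 2 = ∑ j, ‖t j‖ ^ 2 := by
    have hW' : ∀ j l, ∑ i, W i j * W i l = if j = l then 1 else 0 := fun j l => by
      have := congrFun (congrFun hW j) l
      simpa [Matrix.mul_apply, Matrix.one_apply] using this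
    simp only [← real_inner_self_eq_norm_sq, s, sum_inner, inner_sum, inner_smul_left,
      inner_smul_right, RCLike.conj_to_real]
    rw [Finset.sum_comm]
    refine Finset.sum_congr rfl fun j _ => ?_
    simp_rw [Finset.mul_sum]
    rw [Finset.sum_comm]
    simp_rw [← mul_assoc, ← Finset.sum_mul, hW']
    simp
  have hchar := charFun_pi (μ := fun _ : ι => stdGaussian E) s
  simp only [charFun_stdGaussian, ← Complex.exp_sum, ← Finset.sum_div, Finset.sum_neg_distrib]
    at hchar ⊢
  have hs' : ∑ i, (‖s i‖ : ℂ) ^ 2 = ∑ j, (‖t j‖ : ℂ) ^ 2 := by exact_mod_cast hs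
  rw [← hs', ← hchar, charFun_apply, charFun_apply, integral_map (by fun_prop) (by fun_prop),
    integral_map hmeas.aemeasurable (by fun_prop), integral_map (by fun_prop) (by fun_prop)]
  congr 1 with X
  congr 3
  simp only [PiLp.inner_apply, s, sum_inner, inner_sum, inner_smul_left, inner_smul_right,
    RCLike.conj_to_real]
  rw [Finset.sum_comm]

theorem norm_le_iff_forall_le_norm_sub {E : Type*} [NormedAddCommGroup E]
    [InnerProductSpace ℝ E] {k : ℕ} (X : Fin (k + 1) → E) {v : E} {s δ : ℝ}
    (hs : 0 < s) (hδ : 0 < δ) (hv : v ∈ Submodule.span ℝ (Set.range X))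
    (h0 : inner ℝ (X 0) v = s) (hsucc : ∀ i : Fin k, inner ℝ (X i.succ) v = 0) :
    ‖v‖ ≤ δ ↔ ∀ a : Fin k → ℝ, s / δ ≤ ‖X 0 - ∑ i, a i • X i.succ‖ := by
  have hinner : ∀ a : Fin k → ℝ, inner ℝ (X 0 - ∑ i, a i • X i.succ) v = s := fun a => by
    simp [inner_sub_left, sum_inner, inner_smul_left, h0, hsucc]
  have hv0 : 0 < ‖v‖ := by
    rw [norm_pos_iff]
    rintro rfl
    simp at h0
    exact hs.ne h0
  constructor
  · intro h a
    rw [div_le_iff₀ hδ, ← hinner a]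
    exact (real_inner_le_norm _ _).trans (by gcongr)
  · intro h
    obtain ⟨c, hc⟩ := Submodule.mem_span_range_iff_exists_fun ℝ |>.1 hv
    rw [Fin.sum_univ_succ] at hc
    have hsq : ‖v‖ ^ 2 = c 0 * s := by
      rw [← real_inner_self_eq_norm_sq]
      nth_rewrite 1 [← hc]
      simp [inner_add_left, sum_inner, inner_smul_left, h0, hsucc]
    have hc0 : 0 < c 0 := pos_of_mul_pos_left (hsq ▸ by positivity) hs.le
    have hu : X 0 - ∑ i : Fin k, (-(c 0)⁻¹ * c i.succ) • X i.succ = (c 0)⁻¹ • v := by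
      rw [← hc, smul_add, smul_smul, inv_mul_cancel₀ hc0.ne', one_smul, Finset.smul_sum]
      simp [sub_eq_add_neg, smul_smul]
    have := h fun i : Fin k => -(c 0)⁻¹ * c i.succ
    rw [hu, norm_smul, norm_inv, Real.norm_of_nonneg hc0.le, div_le_iff₀ hδ] at this
    have h2 : c 0 * s ≤ ‖v‖ * δ := by
      calc c 0 * s ≤ c 0 * ((c 0)⁻¹ * ‖v‖ * δ) := by gcongr
        _ = ‖v‖ * δ := by field_simp
    rw [← hsq, sq] at h2
    exact le_of_mul_le_mul_left h2 hv0

theorem forall_le_norm_sub_sum_smul_iff {E : Type*} [NormedAddCommGroup E]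
    [InnerProductSpace ℝ E] [FiniteDimensional ℝ E] {k : ℕ} (Y : Fin k → E) (x : E) {r : ℝ} :
    (∀ a : Fin k → ℝ, r ≤ ‖x - ∑ i, a i • Y i‖) ↔
      r ≤ ‖(Submodule.span ℝ (Set.range Y))ᗮ.orthogonalProjectionOnto x‖ := by
  set K := Submodule.span ℝ (Set.range Y)
  constructor
  · intro h
    obtain ⟨a, ha⟩ := Submodule.mem_span_range_iff_exists_fun ℝ |>.1 (K.starProjection_apply_mem x)
    have := h a
    rw [ha] at this
    rwa [← Submodule.starProjection_orthogonal_val] at this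
  · intro h a
    have hmem : ∑ i, a i • Y i ∈ K :=
      Submodule.sum_mem _ fun i _ => K.smul_mem _ (Submodule.subset_span ⟨i, rfl⟩)
    have : Kᗮ.orthogonalProjectionOnto (∑ i, a i • Y i) = 0 :=
      Submodule.orthogonalProjectionOnto_apply_of_mem_orthogonal
        (K.le_orthogonal_orthogonal hmem)
    calc r ≤ ‖Kᗮ.orthogonalProjectionOnto x‖ := h
      _ = ‖Kᗮ.orthogonalProjectionOnto (x - ∑ i, a i • Y i)‖ := by rw [map_sub, this, sub_zero]
      _ ≤ _ := Submodule.norm_orthogonalProjectionOnto_apply_le _ _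

section StdGaussian

variable {E : Type*} [NormedAddCommGroup E] [InnerProductSpace ℝ E] [FiniteDimensional ℝ E]
  [MeasurableSpace E] [BorelSpace E]

theorem map_norm_sq_orthogonalProjection_orthogonal_stdGaussian (K : Submodule ℝ E) {m : ℕ}
    (hK : Module.finrank ℝ K + m = Module.finrank ℝ E) (hm : 0 < m) :
    (stdGaussian E).map (fun x => ‖Kᗮ.orthogonalProjectionOnto x‖ ^ 2)
      = gammaMeasure (m / 2) (1 / 2) := by
  have hfin : Module.finrank ℝ Kᗮ = m := by
    have := K.finrank_add_finrank_orthogonal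
    omega
  rw [← map_norm_sq_stdGaussian hfin hm, ← stdGaussian_map_of_norm_adjoint
    Kᗮ.orthogonalProjectionOnto (fun y => by rw [Submodule.adjoint_orthogonalProjectionOnto]; simp),
    Measure.map_map (by fun_prop) (by fun_prop)]
  rfl

theorem stdGaussian_ae_notMem (K : Submodule ℝ E)
    (hK : Module.finrank ℝ K < Module.finrank ℝ E) : ∀ᵐ x ∂stdGaussian E, x ∉ K := by
  have hm := map_norm_sq_orthogonalProjection_orthogonal_stdGaussian K
    (Nat.add_sub_of_le hK.le) (Nat.sub_pos_of_lt hK)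
  have hne : ∀ᵐ t ∂(stdGaussian E).map (fun x => ‖Kᗮ.orthogonalProjectionOnto x‖ ^ 2), t ≠ 0 := by
    rw [hm]
    exact (withDensity_absolutelyContinuous _ _).ae_le (Measure.ae_ne volume 0)
  filter_upwards [ae_of_ae_map (by fun_prop) hne] with x hx hxK
  refine hx ?_
  have : Kᗮ.orthogonalProjectionOnto x = 0 :=
    Submodule.orthogonalProjectionOnto_apply_of_mem_orthogonal
      (K.le_orthogonal_orthogonal hxK)
  simp [this]

theorem pi_stdGaussian_ae_linearIndependent {k : ℕ} (hk : k ≤ Module.finrank ℝ E) :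
    ∀ᵐ X ∂Measure.pi fun _ : Fin k => stdGaussian E, LinearIndependent ℝ X := by
  induction k with
  | zero => exact Filter.Eventually.of_forall fun X => linearIndependent_empty_type
  | succ k ih =>
    have hmp := measurePreserving_piFinSuccAbove (fun _ : Fin (k + 1) => stdGaussian E) 0
    have hmeas : MeasurableSet {p : E × (Fin k → E) |
        LinearIndependent ℝ (Fin.cons p.1 p.2 : Fin (k + 1) → E)} := by
      have hc : Continuous fun p : E × (Fin k → E) => (Fin.cons p.1 p.2 : Fin (k + 1) → E) := by
        fun_prop
      exact (isOpen_setOfPred_linearIndependent.preimage hc).measurableSet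
    have hprod : ∀ᵐ p ∂(stdGaussian E).prod (Measure.pi fun _ : Fin k => stdGaussian E),
        LinearIndependent ℝ (Fin.cons p.1 p.2 : Fin (k + 1) → E) := by
      rw [Measure.ae_prod_iff_ae_ae hmeas, Measure.ae_ae_comm hmeas]
      filter_upwards [ih (by omega)] with Y hY
      have hfin := finrank_span_eq_card hY
      filter_upwards [stdGaussian_ae_notMem (Submodule.span ℝ (Set.range Y))
        (by rw [hfin, Fintype.card_fin]; omega)] with x hx
      exact linearIndependent_finCons.2 ⟨hY, hx⟩
    filter_upwards [hmp.quasiMeasurePreserving.ae hprod] with X hX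
    convert hX using 1
    exact (Fin.cons_self_tail X).symm

theorem pi_stdGaussian_forall_le_norm_sub {k : ℕ} (hk : k < Module.finrank ℝ E) {r : ℝ}
    (hr : 0 ≤ r) :
    Measure.pi (fun _ : Fin (k + 1) => stdGaussian E)
        {X | ∀ a : Fin k → ℝ, r ≤ ‖X 0 - ∑ i, a i • X i.succ‖}
      = gammaMeasure ((Module.finrank ℝ E - k : ℕ) / 2) (1 / 2) (Set.Ici (r ^ 2)) := by
  have hmp := measurePreserving_piFinSuccAbove (fun _ : Fin (k + 1) => stdGaussian E) 0
  let S : Set (E × (Fin k → E)) := {p | ∀ a : Fin k → ℝ, r ≤ ‖p.1 - ∑ i, a i • p.2 i‖}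
  have hS : MeasurableSet S := by
    have : S = ⋂ a : Fin k → ℝ, {p | r ≤ ‖p.1 - ∑ i, a i • p.2 i‖} := by ext; simp [S]
    rw [this]
    exact (isClosed_iInter fun a => isClosed_le continuous_const (by fun_prop)).measurableSet
  calc _ = (stdGaussian E).prod (Measure.pi fun _ : Fin k => stdGaussian E) S :=
        hmp.measure_preimage hS.nullMeasurableSet
    _ = ∫⁻ _ : Fin k → E, gammaMeasure ((Module.finrank ℝ E - k : ℕ) / 2) (1 / 2) (Set.Ici (r ^ 2))
        ∂Measure.pi fun _ : Fin k => stdGaussian E := by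
        rw [Measure.prod_apply_symm hS]
        refine lintegral_congr_ae ?_
        filter_upwards [pi_stdGaussian_ae_linearIndependent (E := E) hk.le] with Y hY
        have hfin := finrank_span_eq_card hY
        rw [Fintype.card_fin] at hfin
        rw [← map_norm_sq_orthogonalProjection_orthogonal_stdGaussian
          (Submodule.span ℝ (Set.range Y)) (by omega) (Nat.sub_pos_of_lt hk),
          Measure.map_apply (by fun_prop) measurableSet_Ici]
        congr 1 with x
        simp only [S, Set.mem_preimage, Set.mem_ofPred_eq, Set.mem_Ici,
          forall_le_norm_sub_sum_smul_iff]
        exact (sq_le_sq₀ hr (norm_nonneg _)).symm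
    _ = _ := by simp

end StdGaussian

theorem map_toLp_gaussMatrix (D d : ℕ) :
    (gaussMatrix D d).map (fun A i => WithLp.toLp 2 (A i))
      = Measure.pi fun _ : Fin D => stdGaussian (EuclideanSpace ℝ (Fin d)) := by
  rw [gaussMatrix, Measure.pi_map_pi (fun _ => by fun_prop)]
  simp_rw [map_pi_eq_stdGaussian]

theorem exists_orthonormalBasis_inner_eq {k : ℕ} {z : EuclideanSpace ℝ (Fin (k + 1))}
    (hz : z ≠ 0) : ∃ b : OrthonormalBasis (Fin (k + 1)) ℝ (EuclideanSpace ℝ (Fin (k + 1))),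
      inner ℝ (b 0) z = ‖z‖ ∧ ∀ i : Fin k, inner ℝ (b i.succ) z = 0 := by
  have hz' : ‖z‖ ≠ 0 := norm_ne_zero_iff.2 hz
  obtain ⟨b, hb⟩ := Orthonormal.exists_orthonormalBasis_extension_of_card_eq (𝕜 := ℝ)
    (E := EuclideanSpace ℝ (Fin (k + 1))) (ι := Fin (k + 1)) (by simp)
    (v := fun _ => ‖z‖⁻¹ • z) (s := {0}) (by
      rw [orthonormal_iff_ite]
      rintro ⟨i, rfl⟩ ⟨j, rfl⟩
      simp [norm_smul, hz'])
  have hzb : z = ‖z‖ • b 0 := by simp [hb 0 rfl, smul_smul, hz']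
  refine ⟨b, ?_, fun i => ?_⟩
  · nth_rewrite 1 [hzb]
    simp [inner_smul_right]
  · rw [hzb]
    simp [inner_smul_right, b.inner_eq_ite]

theorem sum_sq_mulVec_of_transpose_mul_self {ι κ : Type*} [Fintype ι] [Fintype κ] [DecidableEq κ]
    {U : Matrix ι κ ℝ} (hU : Uᵀ * U = 1) (z : κ → ℝ) :
    ∑ i, (U *ᵥ z) i ^ 2 = ∑ i, z i ^ 2 := by
  have : (U *ᵥ z) ⬝ᵥ (U *ᵥ z) = z ⬝ᵥ z := by
    rw [Matrix.dotProduct_mulVec, ← Matrix.mulVec_transpose, Matrix.mulVec_mulVec, hU,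
      Matrix.one_mulVec]
  simpa [dotProduct, sq] using this

theorem norm_pinv_le_iff {k d : ℕ} (B : Matrix (Fin (k + 1)) (Fin d) ℝ)
    (b : OrthonormalBasis (Fin (k + 1)) ℝ (EuclideanSpace ℝ (Fin (k + 1))))
    {z : EuclideanSpace ℝ (Fin (k + 1))} (hz : z ≠ 0) (h0 : inner ℝ (b 0) z = ‖z‖)
    (hsucc : ∀ i : Fin k, inner ℝ (b i.succ) z = 0) (X : Fin (k + 1) → EuclideanSpace ℝ (Fin d))
    (hX : ∀ j, X j = ∑ l, b j l • WithLp.toLp 2 (B l)) (hXli : LinearIndependent ℝ X)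
    {δ : ℝ} (hδ : 0 < δ) :
    IsUnit (B * Bᵀ) ∧ (‖WithLp.toLp 2 ((Bᵀ * (B * Bᵀ)⁻¹) *ᵥ z.ofLp)‖ ≤ δ ↔
      ∀ a : Fin k → ℝ, ‖z‖ / δ ≤ ‖X 0 - ∑ i, a i • X i.succ‖) := by
  let R : Fin (k + 1) → EuclideanSpace ℝ (Fin d) := fun l => WithLp.toLp 2 (B l)
  have hXR : Submodule.span ℝ (Set.range X) ≤ Submodule.span ℝ (Set.range R) := by
    rw [Submodule.span_le]
    rintro _ ⟨j, rfl⟩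
    rw [hX]
    exact Submodule.sum_mem _ fun l _ => Submodule.smul_mem _ _ (Submodule.subset_span ⟨l, rfl⟩)
  have hR : LinearIndependent ℝ R := by
    rw [linearIndependent_iff_card_le_finrank_span, ← finrank_span_eq_card hXli]
    exact Submodule.finrank_mono hXR
  have hspan : Submodule.span ℝ (Set.range X) = Submodule.span ℝ (Set.range R) :=
    Submodule.eq_of_le_of_finrank_eq hXR
      ((finrank_span_eq_card hXli).trans (finrank_span_eq_card hR).symm)
  have hgram : B * Bᵀ = Matrix.gram ℝ R := by
    ext i j
    simp [Matrix.gram, Matrix.mul_apply, R, PiLp.inner_apply, mul_comm]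
  have hunit : IsUnit (B * Bᵀ) := hgram ▸ (Matrix.posDef_gram_of_linearIndependent hR).isUnit
  refine ⟨hunit, ?_⟩
  set y : Fin d → ℝ := (Bᵀ * (B * Bᵀ)⁻¹) *ᵥ z.ofLp
  have hBy : B *ᵥ y = z.ofLp := by
    rw [Matrix.mulVec_mulVec, ← Matrix.mul_assoc,
      Matrix.mul_nonsing_inv _ ((Matrix.isUnit_iff_isUnit_det _).1 hunit), Matrix.one_mulVec]
  have hRy : ∀ l, inner ℝ (R l) (WithLp.toLp 2 y) = z l := fun l => by
    rw [← hBy]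
    simp [R, PiLp.inner_apply, Matrix.mulVec, dotProduct, mul_comm]
  have hXy : ∀ j, inner ℝ (X j) (WithLp.toLp 2 y) = inner ℝ (b j) z := fun j => by
    rw [hX, sum_inner]
    simp only [inner_smul_left]
    simp_rw [show ∀ l, inner ℝ (WithLp.toLp 2 (B l)) (WithLp.toLp 2 y) = z l from hRy]
    simp [PiLp.inner_apply, mul_comm]
  refine norm_le_iff_forall_le_norm_sub X (norm_pos_iff.2 hz) hδ ?_ ((hXy 0).trans h0)
    fun i => (hXy _).trans (hsucc i)
  rw [hspan, Submodule.mem_span_range_iff_exists_fun]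
  refine ⟨(B * Bᵀ)⁻¹ *ᵥ z.ofLp, ?_⟩
  ext i
  simp only [y, ← Matrix.mulVec_mulVec]
  simp [R, Matrix.mulVec, dotProduct, mul_comm]

theorem sum_mul_smul_toLp_eq {ι κ m n : Type*} [Fintype ι] [Fintype κ] (U : Matrix ι κ ℝ)
    (Q : Matrix κ m ℝ) (A : ι → n → ℝ) (j : m) :
    ∑ i, (U * Q) i j • WithLp.toLp 2 (A i) =
      ∑ l, Q l j • WithLp.toLp 2 ((Uᵀ * Matrix.of A) l) := by
  ext c
  simp only [Matrix.mul_apply, Matrix.of_apply, Matrix.transpose_apply, WithLp.ofLp_sum,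
    WithLp.ofLp_smul, Finset.sum_apply, Pi.smul_apply, smul_eq_mul, Finset.sum_mul,
    Finset.mul_sum]
  rw [Finset.sum_comm]
  exact Finset.sum_congr rfl fun _ _ => Finset.sum_congr rfl fun _ _ => by ring

theorem stmt5 (D d de : ℕ) (hD : 0 < D) (hd : 0 < d) (hde : 0 < de)
    (h1 : de ≤ d) (h2 : d ≤ D)
    (U : Matrix (Fin D) (Fin de) ℝ) (hU : U.transpose * U = 1)
    (zstar : Fin de → ℝ) (hz : zstar ≠ 0)
    (y2 : (Fin D → Fin d → ℝ) → (Fin d → ℝ))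
    (hy2 : ∀ A : Fin D → Fin d → ℝ,
      IsUnit ((U.transpose * Matrix.of A) * (U.transpose * Matrix.of A).transpose) →
      y2 A = ((U.transpose * Matrix.of A).transpose *
        ((U.transpose * Matrix.of A) * (U.transpose * Matrix.of A).transpose)⁻¹).mulVec zstar)
    (δ : ℝ) (hδ : 0 < δ) :
    gaussMatrix D d {A | Real.sqrt (∑ i, (y2 A) i ^ 2) ≤ δ}
      = chiSq (d - de + 1) {t : ℝ | (∑ i, (U.mulVec zstar) i ^ 2) / δ ^ 2 ≤ t} := by
  obtain ⟨k, rfl⟩ : ∃ k, de = k + 1 := ⟨de - 1, by omega⟩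
  let z : EuclideanSpace ℝ (Fin (k + 1)) := WithLp.toLp 2 zstar
  have hz0 : z ≠ 0 := by simpa [z] using hz
  obtain ⟨b, hb0, hbsucc⟩ := exists_orthonormalBasis_inner_eq hz0
  let Q : Matrix (Fin (k + 1)) (Fin (k + 1)) ℝ := Matrix.of fun l j => b j l
  have hQ : Qᵀ * Q = 1 := by
    ext i j
    have := b.inner_eq_ite i j
    rw [PiLp.inner_apply] at this
    simpa [Matrix.mul_apply, Matrix.one_apply, Q, mul_comm] using this
  let W : Matrix (Fin D) (Fin (k + 1)) ℝ := U * Q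
  have hW : Wᵀ * W = 1 := by
    rw [Matrix.transpose_mul, Matrix.mul_assoc, ← Matrix.mul_assoc Uᵀ, hU, Matrix.one_mul, hQ]
  let F : (Fin D → Fin d → ℝ) → Fin (k + 1) → EuclideanSpace ℝ (Fin d) :=
    fun A j => ∑ i, W i j • WithLp.toLp 2 (A i)
  have hF : Measurable F := by fun_prop
  have hmap : (gaussMatrix D d).map F =
      Measure.pi fun _ => stdGaussian (EuclideanSpace ℝ (Fin d)) := by
    rw [← pi_stdGaussian_map_sum_smul W hW, ← map_toLp_gaussMatrix,
      Measure.map_map (by fun_prop) (by fun_prop)]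
    rfl
  have hnorm : ∑ i, (U *ᵥ zstar) i ^ 2 = ‖z‖ ^ 2 := by
    rw [sum_sq_mulVec_of_transpose_mul_self hU, EuclideanSpace.real_norm_sq_eq]
  have hS : MeasurableSet {X : Fin (k + 1) → EuclideanSpace ℝ (Fin d) |
      ∀ a : Fin k → ℝ, ‖z‖ / δ ≤ ‖X 0 - ∑ i, a i • X i.succ‖} := by
    rw [Set.ofPred_forall]
    exact (isClosed_iInter fun a => isClosed_le continuous_const (by fun_prop)).measurableSet
  have hli : ∀ᵐ A ∂gaussMatrix D d, LinearIndependent ℝ (F A) :=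
    ae_of_ae_map hF.aemeasurable
      (hmap ▸ pi_stdGaussian_ae_linearIndependent (by simpa using h1))
  calc gaussMatrix D d {A | √(∑ i, y2 A i ^ 2) ≤ δ}
      = gaussMatrix D d (F ⁻¹' {X | ∀ a : Fin k → ℝ,
          ‖z‖ / δ ≤ ‖X 0 - ∑ i, a i • X i.succ‖}) := by
        refine measure_congr ?_
        filter_upwards [hli] with A hA
        obtain ⟨hunit, hiff⟩ := norm_pinv_le_iff (Uᵀ * Matrix.of A) b hz0 hb0 hbsucc (F A)
          (fun j => sum_mul_smul_toLp_eq U Q A j) hA hδ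
        rw [← hy2 A hunit, EuclideanSpace.norm_eq] at hiff
        simp only [Real.norm_eq_abs, sq_abs] at hiff
        exact propext hiff
    _ = chiSq (d - (k + 1) + 1) {t : ℝ | (∑ i, (U *ᵥ zstar) i ^ 2) / δ ^ 2 ≤ t} := by
        have hfin : Module.finrank ℝ (EuclideanSpace ℝ (Fin d)) = d := by simp
        rw [← Measure.map_apply hF hS, hmap,
          pi_stdGaussian_forall_le_norm_sub (by omega) (by positivity), hfin, hnorm, ← div_pow,
          chiSq, show d - (k + 1) + 1 = d - k by omega]
        rfl
end

section
/- Let D, d, d_e be positive integers with d_e ≤ d ≤ D and d − d_e > 1. Let U ∈ ℝ^{D×d_e} have orthonormal columns, let z* ∈ ℝ^{d_e} be nonzero, and set x_T* = U z*. For a D×d matrix A define y₂*(A) = Bᵀ (B Bᵀ)⁻¹ z* where B = Uᵀ A (defined for the almost-every A for which B Bᵀ is invertible, with an arbitrary value otherwise). Then the expectation of ‖y₂*(A)‖₂² under the Gaussian matrix measure equals ‖x_T*‖₂² / (d − d_e − 1), i.e. ∫ ‖y₂*(A)‖₂² dμ(A) = ‖x_T*‖₂² / (d − d_e − 1) where μ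 is the Gaussian matrix measure on D×d matrices. -/
open MeasureTheory ProbabilityTheory Matrix

lemma charFunDual_gaussianReal_zero_one (L : StrongDual ℝ ℝ) :
    charFunDual (gaussianReal 0 1) L = Complex.exp (-((L 1 ^ 2 : ℝ) : ℂ) / 2) := by
  have h : ∀ v, L v = L 1 * v := fun v => by
    have := L.map_smul v 1
    rwa [smul_eq_mul, smul_eq_mul, mul_one, mul_comm] at this
  have := charFun_gaussianReal (μ := 0) (v := 1) (L 1)
  rw [charFun_apply_real] at this
  have h' : (fun v : ℝ => Complex.exp (L v * Complex.I)) =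
      fun v : ℝ => Complex.exp (L 1 * v * Complex.I) :=
    funext fun v => by rw [h v, Complex.ofReal_mul]
  rw [charFunDual_apply, h', this]
  congr 1
  simp
  ring

lemma charFunDual_pi_gaussianReal {ι : Type*} [Fintype ι] [DecidableEq ι]
    (L : StrongDual ℝ (ι → ℝ)) :
    charFunDual (Measure.pi fun _ : ι => gaussianReal 0 1) L =
      Complex.exp (-((∑ i, L (Pi.single i 1) ^ 2 : ℝ) : ℂ) / 2) := by
  rw [charFunDual_pi]
  simp_rw [charFunDual_gaussianReal_zero_one, ← Complex.exp_sum]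
  congr 1
  simp [← Finset.sum_div]

lemma charFunDual_gaussMatrix {D d : ℕ} (L : StrongDual ℝ (Fin D → Fin d → ℝ)) :
    charFunDual (gaussMatrix D d) L =
      Complex.exp (-((∑ i, ∑ j, L (Pi.single i (Pi.single j 1)) ^ 2 : ℝ) : ℂ) / 2) := by
  rw [gaussMatrix, charFunDual_pi]
  simp_rw [charFunDual_pi_gaussianReal, ← Complex.exp_sum]
  congr 1
  simp [← Finset.sum_div]

lemma sum_sq_vecMul_of_mul_transpose_eq_one {ι κ : Type*} [Fintype ι] [Fintype κ] [DecidableEq κ]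
    {M : Matrix κ ι ℝ} (hM : M * Mᵀ = 1) (l : κ → ℝ) :
    ∑ i, (∑ k, M k i * l k) ^ 2 = ∑ k, l k ^ 2 := by
  have h : (Mᵀ *ᵥ l) ⬝ᵥ (Mᵀ *ᵥ l) = l ⬝ᵥ l := by
    rw [dotProduct_mulVec, vecMul_transpose, mulVec_mulVec, hM, one_mulVec]
  simpa [dotProduct, mulVec, sq] using h

/-- A matrix with orthonormal rows maps standard Gaussian vectors to standard Gaussian vectors. -/
lemma measurePreserving_mulVec_pi_gaussianReal {ι κ : Type*} [Fintype ι] [Fintype κ]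
    [DecidableEq κ] {M : Matrix κ ι ℝ} (hM : M * Mᵀ = 1) :
    MeasurePreserving (fun x => M *ᵥ x) (Measure.pi fun _ : ι => gaussianReal 0 1)
      (Measure.pi fun _ : κ => gaussianReal 0 1) := by
  classical
  let T : (ι → ℝ) →L[ℝ] (κ → ℝ) := LinearMap.toContinuousLinearMap M.mulVecLin
  refine ⟨T.continuous.measurable, ?_⟩
  change Measure.map T _ = _
  refine Measure.ext_of_charFunDual (funext fun L => ?_)
  rw [charFunDual_map, charFunDual_pi_gaussianReal, charFunDual_pi_gaussianReal,
    ← sum_sq_vecMul_of_mul_transpose_eq_one hM]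
  have h : ∀ i, (L ∘SL T) (Pi.single i 1) = ∑ k, M k i * L (Pi.single k 1) := fun i => by
    have : T (Pi.single i 1) = ∑ k, M k i • (Pi.single k 1 : κ → ℝ) := by
      ext k
      simp [T, Finset.sum_apply, Pi.single_apply]
    simp [this]
  simp_rw [h]

/-- Left multiplication by a matrix with orthonormal rows maps Gaussian matrices to Gaussian
matrices. -/
lemma measurePreserving_mul_gaussMatrix {D m : ℕ} (d : ℕ) {M : Matrix (Fin m) (Fin D) ℝ}
    (hM : M * Mᵀ = 1) :
    MeasurePreserving (fun A : Fin D → Fin d → ℝ => fun i j => (M * Matrix.of A) i j)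
      (gaussMatrix D d) (gaussMatrix m d) := by
  let T₀ : (Fin D → Fin d → ℝ) →ₗ[ℝ] (Fin m → Fin d → ℝ) :=
    { toFun := fun A i j => (M * Matrix.of A) i j
      map_add' := fun A B => by ext; simp [Matrix.mul_apply, mul_add, Finset.sum_add_distrib]
      map_smul' := fun c A => by ext; simp [Matrix.mul_apply, Finset.mul_sum, mul_left_comm] }
  let T := LinearMap.toContinuousLinearMap T₀
  refine ⟨T.continuous.measurable, ?_⟩
  change Measure.map T _ = _
  have : IsFiniteMeasure (gaussMatrix D d) := by unfold gaussMatrix; infer_instance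
  have : IsFiniteMeasure (gaussMatrix m d) := by unfold gaussMatrix; infer_instance
  refine Measure.ext_of_charFunDual (funext fun L => ?_)
  rw [charFunDual_map, charFunDual_gaussMatrix, charFunDual_gaussMatrix, Finset.sum_comm,
    Finset.sum_comm (s := (Finset.univ : Finset (Fin m)))]
  have h : ∀ i j, (L ∘SL T) (Pi.single i (Pi.single j 1)) =
      ∑ k, M k i * L (Pi.single k (Pi.single j 1)) := fun i j => by
    have : T (Pi.single i (Pi.single j 1)) =
        ∑ k, M k i • (Pi.single k (Pi.single j 1) : Fin m → Fin d → ℝ) := by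
      ext k j'
      rcases eq_or_ne j j' with rfl | hj
      · simp [T, T₀, Matrix.mul_apply, Finset.sum_apply, Pi.single_apply, apply_ite, ite_apply]
      · simp [T, T₀, Matrix.mul_apply, Finset.sum_apply, Pi.single_apply, ite_apply, hj.symm]
    simp [this]
  simp_rw [h, sum_sq_vecMul_of_mul_transpose_eq_one hM]

lemma integral_exp_neg_mul_sq_gaussianReal {t : ℝ} (ht : 0 < t) :
    ∫ x, Real.exp (-(t * x ^ 2)) ∂(gaussianReal 0 1) = (1 + 2 * t) ^ (-1 / 2 : ℝ) := by
  rw [integral_gaussianReal_eq_integral_smul one_ne_zero]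
  have h : ∀ x : ℝ, gaussianPDFReal 0 1 x • Real.exp (-(t * x ^ 2)) =
      (√(2 * Real.pi))⁻¹ * Real.exp (-(t + 1 / 2) * x ^ 2) := fun x => by
    simp only [gaussianPDFReal, smul_eq_mul, mul_assoc, ← Real.exp_add]
    congr 2
    · simp
    · simp; ring
  simp_rw [h]
  rw [integral_const_mul, integral_gaussian, ← Real.sqrt_inv, ← Real.sqrt_mul (by positivity),
    neg_div, Real.rpow_neg (by positivity), ← Real.sqrt_eq_rpow, ← Real.sqrt_inv]
  congr 1
  have := Real.pi_ne_zero
  field_simp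
  ring

lemma lintegral_exp_neg_mul_sum_sq {ι : Type*} [Fintype ι] {t : ℝ} (ht : 0 < t) :
    ∫⁻ x, ENNReal.ofReal (Real.exp (-(∑ i, x i ^ 2) * t))
        ∂(Measure.pi fun _ : ι => gaussianReal 0 1) =
      ENNReal.ofReal ((1 + 2 * t) ^ (-(Fintype.card ι / 2) : ℝ)) := by
  have h : ∀ x : ι → ℝ, Real.exp (-(∑ i, x i ^ 2) * t) = ∏ i, Real.exp (-(t * x i ^ 2)) :=
    fun x => by
      rw [← Real.exp_sum, Finset.sum_neg_distrib, ← Finset.mul_sum]; congr 1; ring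
  rw [← ofReal_integral_eq_lintegral_ofReal]
  · simp_rw [h]
    rw [integral_fintype_prod_eq_pow (fun x => Real.exp (-(t * x ^ 2))),
      integral_exp_neg_mul_sq_gaussianReal ht, ← Real.rpow_natCast, ← Real.rpow_mul (by positivity)]
    congr 2
    ring
  · refine Integrable.of_bound (C := 1) (Measurable.aestronglyMeasurable (by fun_prop)) (.of_forall fun x => ?_)
    rw [Real.norm_eq_abs, Real.abs_exp, Real.exp_le_one_iff]
    have : 0 ≤ ∑ i, x i ^ 2 := Finset.sum_nonneg fun i _ => sq_nonneg _
    nlinarith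
  · exact .of_forall fun x => (Real.exp_pos _).le

lemma lintegral_Ioi_one_add_two_mul_rpow {k : ℝ} (hk : 2 < k) :
    ∫⁻ t in Set.Ioi (0 : ℝ), ENNReal.ofReal ((1 + 2 * t) ^ (-(k / 2))) =
      ENNReal.ofReal (1 / (k - 2)) := by
  have hd : ∀ t ∈ Set.Ici (0 : ℝ), HasDerivAt
      (fun t : ℝ => -(1 + 2 * t) ^ (1 - k / 2) / (k - 2)) ((1 + 2 * t) ^ (-(k / 2))) t := by
    intro t ht
    have ht : 0 ≤ t := ht
    have h1 : HasDerivAt (fun t : ℝ => 1 + 2 * t) 2 t := by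
      simpa using ((hasDerivAt_id t).const_mul 2).const_add 1
    have := ((h1.rpow_const (p := 1 - k / 2) (Or.inl (by positivity))).neg).div_const (k - 2)
    refine this.congr_deriv ?_
    rw [show 1 - k / 2 - 1 = -(k / 2) by ring]
    have : k - 2 ≠ 0 := by linarith
    field_simp
    ring
  have hp : ∀ t ∈ Set.Ioi (0 : ℝ), 0 ≤ (1 + 2 * t) ^ (-(k / 2)) := fun t ht => by
    have ht : 0 < t := ht
    positivity
  have hl : Filter.Tendsto (fun t : ℝ => -(1 + 2 * t) ^ (1 - k / 2) / (k - 2)) Filter.atTop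
      (nhds 0) := by
    have h2 : Filter.Tendsto (fun t : ℝ => 1 + 2 * t) Filter.atTop Filter.atTop :=
      Filter.tendsto_atTop_add_const_left _ _ (Filter.tendsto_id.const_mul_atTop two_pos)
    have h3 := (tendsto_rpow_neg_atTop (y := k / 2 - 1) (by linarith)).comp h2
    have := (h3.neg).div_const (k - 2)
    simpa [Function.comp_def] using this
  rw [← ofReal_integral_eq_lintegral_ofReal (integrableOn_Ioi_deriv_of_nonneg' hd hp hl)
    ((ae_restrict_mem measurableSet_Ioi).mono hp),
    integral_Ioi_of_hasDerivAt_of_nonneg' hd hp hl]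
  congr 1
  simp
  ring

lemma lintegral_Ioi_exp_neg_mul {s : ℝ} (hs : 0 < s) :
    ∫⁻ t in Set.Ioi (0 : ℝ), ENNReal.ofReal (Real.exp (-s * t)) = ENNReal.ofReal s⁻¹ := by
  rw [← ofReal_integral_eq_lintegral_ofReal (integrableOn_exp_mul_Ioi (by linarith) 0)
    (.of_forall fun _ => (Real.exp_pos _).le), integral_exp_mul_Ioi (by linarith)]
  simp

/-- The inverse of a chi-squared variable with `k > 2` degrees of freedom has mean `1 / (k - 2)`. -/
lemma lintegral_inv_sum_sq_gaussianReal {k : ℕ} (hk : 2 < k) :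
    ∫⁻ x, ENNReal.ofReal (∑ i, x i ^ 2)⁻¹ ∂(Measure.pi fun _ : Fin k => gaussianReal 0 1) =
      ENNReal.ofReal (1 / ((k : ℝ) - 2)) := by
  have := nullSingletonClass_gaussianReal (μ := 0) (v := 1) one_ne_zero
  have hne : ∀ᵐ x ∂(Measure.pi fun _ : Fin k => gaussianReal 0 1), 0 < ∑ i, x i ^ 2 := by
    have h0 := Measure.pi_hyperplane (fun _ : Fin k => gaussianReal 0 1) ⟨0, by omega⟩ (0 : ℝ)
    filter_upwards [compl_mem_ae_iff.2 h0] with x hx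
    exact Finset.sum_pos' (fun i _ => sq_nonneg _) ⟨_, Finset.mem_univ _, sq_pos_of_ne_zero hx⟩
  calc _ = ∫⁻ x : Fin k → ℝ,
          (∫⁻ t in Set.Ioi (0 : ℝ), ENNReal.ofReal (Real.exp (-(∑ i, x i ^ 2) * t)))
        ∂(Measure.pi fun _ : Fin k => gaussianReal 0 1) :=
        lintegral_congr_ae (hne.mono fun x hx => (lintegral_Ioi_exp_neg_mul hx).symm)
    _ = ∫⁻ t in Set.Ioi (0 : ℝ), ENNReal.ofReal ((1 + 2 * t) ^ (-((k : ℝ) / 2))) := by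
        rw [lintegral_lintegral_swap (Measurable.aemeasurable (by fun_prop))]
        refine setLIntegral_congr_fun measurableSet_Ioi fun t ht => ?_
        simpa using lintegral_exp_neg_mul_sum_sq (ι := Fin k) ht
    _ = _ := lintegral_Ioi_one_add_two_mul_rpow (by exact_mod_cast hk)

lemma det_mul_transpose_ne_zero_iff {m d : ℕ} {C : Matrix (Fin m) (Fin d) ℝ} :
    (C * Cᵀ).det ≠ 0 ↔ LinearIndependent ℝ C.row := by
  refine ⟨fun h => ?_, fun h => ?_⟩
  · rw [← Matrix.vecMul_injective_iff]
    intro v w hvw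
    have h' : IsUnit (C * Cᵀ) := (Matrix.isUnit_iff_isUnit_det _).2 h.isUnit
    refine Matrix.vecMul_injective_of_isUnit h' ?_
    have := congrArg (fun u => u ᵥ* Cᵀ) hvw
    simpa [vecMul_vecMul] using this
  · have := Matrix.PosDef.mul_conjTranspose_self C (Matrix.vecMul_injective_iff.2 h)
    rw [conjTranspose_eq_transpose_of_trivial] at this
    exact this.det_pos.ne'

/-- A matrix whose rows form an orthonormal basis of the orthogonal complement of the span of
linearly independent vectors. -/
lemma exists_orthonormal_rows_of_orthogonal {n d : ℕ} {R : Fin n → Fin d → ℝ}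
    (hR : LinearIndependent ℝ R) :
    ∃ N : Matrix (Fin (d - n)) (Fin d) ℝ, N * Nᵀ = 1 ∧ (∀ i, N *ᵥ R i = 0) ∧
      ∀ w, (∀ i, R i ⬝ᵥ w = 0) → ∑ a, (N *ᵥ w) a ^ 2 = ∑ j, w j ^ 2 := by
  let e := (WithLp.linearEquiv 2 ℝ (Fin d → ℝ)).symm
  let R' : Fin n → EuclideanSpace ℝ (Fin d) := fun i => e (R i)
  have hR' : LinearIndependent ℝ R' := hR.map' e.toLinearMap e.ker
  let K := Submodule.span ℝ (Set.range R')
  have hK : Module.finrank ℝ Kᗮ = d - n := by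
    have h1 := K.finrank_add_finrank_orthogonal
    rw [finrank_span_eq_card hR', Fintype.card_fin, finrank_euclideanSpace, Fintype.card_fin] at h1
    omega
  obtain ⟨b⟩ : Nonempty (OrthonormalBasis (Fin (d - n)) ℝ Kᗮ) :=
    ⟨(stdOrthonormalBasis ℝ Kᗮ).reindex (finCongr hK)⟩
  let N : Matrix (Fin (d - n)) (Fin d) ℝ := Matrix.of fun a j => (b a : EuclideanSpace ℝ (Fin d)) j
  have hN : ∀ a w, (N *ᵥ w) a = inner ℝ (b a : EuclideanSpace ℝ (Fin d)) (WithLp.toLp 2 w) :=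
    fun a w => by simp [N, mulVec, dotProduct, PiLp.inner_apply, mul_comm]
  refine ⟨N, ?_, fun i => funext fun a => ?_, fun w hw => ?_⟩
  · ext a a'
    have := orthonormal_iff_ite.1 b.orthonormal a a'
    rw [Submodule.coe_inner] at this
    change (N *ᵥ N a') a = _
    rw [hN, Matrix.one_apply, ← this]
    rfl
  · rw [hN]
    exact Submodule.inner_left_of_mem_orthogonal
      (Submodule.subset_span (Set.mem_range_self i)) (b a).2
  · have hwK : WithLp.toLp 2 w ∈ Kᗮ := by
      rw [Submodule.mem_orthogonal]
      intro u hu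
      induction hu using Submodule.span_induction with
      | mem x hx =>
        obtain ⟨i, rfl⟩ := hx
        rw [← hw i]
        simp [R', e, PiLp.inner_apply, dotProduct, mul_comm]
      | zero => simp
      | add x y _ _ hx hy => rw [inner_add_left, hx, hy, add_zero]
      | smul c x _ hx => rw [inner_smul_left, hx, mul_zero]
    have := b.sum_sq_norm_inner_right ⟨_, hwK⟩
    simp only [Submodule.coe_inner, Submodule.coe_norm, Real.norm_eq_abs, sq_abs] at this
    simp_rw [hN, this, EuclideanSpace.real_norm_sq_eq]

lemma exists_orthogonal_transpose_mulVec_eq {n : ℕ} {z : Fin (n + 1) → ℝ} (hz : z ≠ 0) :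
    ∃ O : Matrix (Fin (n + 1)) (Fin (n + 1)) ℝ, ∃ s : ℝ, Oᵀ * O = 1 ∧
      Oᵀ *ᵥ z = s • Pi.single 0 1 ∧ s ^ 2 = ∑ i, z i ^ 2 := by
  let z' : EuclideanSpace ℝ (Fin (n + 1)) := WithLp.toLp 2 z
  have hz' : ‖z'‖ ≠ 0 := by simpa [z'] using hz
  let v : Fin (n + 1) → EuclideanSpace ℝ (Fin (n + 1)) := fun _ => ‖z'‖⁻¹ • z'
  have hv : Orthonormal ℝ (({0} : Set (Fin (n + 1))).domRestrict v) := by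
    refine ⟨fun i => ?_, fun i j hij => absurd (Subsingleton.elim i j) hij⟩
    simp [v, norm_smul, hz']
  obtain ⟨b, hb⟩ := hv.exists_orthonormalBasis_extension_of_card_eq (by simp)
  have hb0 : z' = ‖z'‖ • b 0 := by
    rw [hb 0 rfl, smul_smul, mul_inv_cancel₀ hz', one_smul]
  refine ⟨Matrix.of fun i j => b j i, ‖z'‖, ?_, ?_, ?_⟩
  · ext i j
    rw [Matrix.one_apply, ← orthonormal_iff_ite.1 b.orthonormal i j]
    simp [Matrix.mul_apply, PiLp.inner_apply, mul_comm]
  · ext j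
    have h1 : inner ℝ (b j) z' = ‖z'‖ * if j = 0 then 1 else 0 := by
      conv_lhs => rw [hb0]
      rw [inner_smul_right, orthonormal_iff_ite.1 b.orthonormal]
    have h2 : ((Matrix.of fun i j => b j i : Matrix (Fin (n + 1)) (Fin (n + 1)) ℝ)ᵀ *ᵥ z) j
        = inner ℝ (b j) z' := by
      simp [mulVec, dotProduct, PiLp.inner_apply, z', mul_comm]
    rw [h2, h1]
    simp [Pi.single_apply]
  · rw [EuclideanSpace.real_norm_sq_eq]

/-- The minimum-norm solution `w` of `C w = e₀`. -/
noncomputable def minNormSolution {m d : ℕ} [NeZero m] (C : Matrix (Fin m) (Fin d) ℝ) :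
    Fin d → ℝ :=
  (Cᵀ * (C * Cᵀ)⁻¹) *ᵥ Pi.single 0 1

lemma sum_sq_minNormSolution {n d : ℕ} {C : Matrix (Fin (n + 1)) (Fin d) ℝ}
    {k : ℕ} {N : Matrix (Fin k) (Fin d) ℝ}
    (hC : (C * Cᵀ).det ≠ 0) (hN : ∀ i : Fin n, N *ᵥ C i.succ = 0)
    (hN' : ∀ w, (∀ i : Fin n, C i.succ ⬝ᵥ w = 0) → ∑ a, (N *ᵥ w) a ^ 2 = ∑ j, w j ^ 2) :
    ∑ j, minNormSolution C j ^ 2 = (∑ a, (N *ᵥ C 0) a ^ 2)⁻¹ := by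
  set w := minNormSolution C with hw
  set g := (C * Cᵀ)⁻¹ *ᵥ Pi.single 0 1 with hg
  have hwg : w = Cᵀ *ᵥ g := by rw [hw, minNormSolution, hg, mulVec_mulVec]
  have hCw : C *ᵥ w = Pi.single 0 1 := by
    rw [hwg, hg, mulVec_mulVec, mulVec_mulVec, Matrix.mul_nonsing_inv _ hC.isUnit, one_mulVec]
  have hnorm : ∑ j, w j ^ 2 = g 0 := by
    have : w ⬝ᵥ w = g 0 := by
      nth_rw 2 [hwg]
      rw [dotProduct_mulVec, vecMul_transpose, hCw]
      simp
    simpa [dotProduct, sq] using this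
  have hNw : N *ᵥ w = g 0 • (N *ᵥ C 0) := by
    have : w = ∑ i, g i • C i := by
      rw [hwg]; ext j; simp [mulVec, dotProduct, Finset.sum_apply, mul_comm]
    rw [this, ← mulVecLin_apply, map_sum, Fin.sum_univ_succ]
    simp [hN]
  have h := hN' w fun i => (congrFun hCw i.succ).trans (by simp)
  rw [hNw, hnorm] at h
  simp only [Pi.smul_apply, smul_eq_mul, mul_pow, ← Finset.mul_sum] at h
  have hg0 : g 0 ≠ 0 := by
    intro h0
    rw [h0, Finset.sum_eq_zero_iff_of_nonneg fun _ _ => sq_nonneg _] at hnorm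
    have hw0 : w = 0 := funext fun j => by simpa using hnorm j (Finset.mem_univ j)
    have := congrFun hCw 0
    simp [hw0] at this
  rw [hnorm]
  refine eq_inv_of_mul_eq_one_left ?_
  have : g 0 * (g 0 * ∑ a, (N *ᵥ C 0) a ^ 2) = g 0 * 1 := by linarith
  exact mul_left_cancel₀ hg0 this

@[fun_prop]
lemma measurable_minNormSolution {m d : ℕ} [NeZero m] :
    Measurable fun C : Fin m → Fin d → ℝ => minNormSolution (Matrix.of C) := by
  have h1 : Continuous fun C : Fin m → Fin d → ℝ => (Matrix.of C : Matrix (Fin m) (Fin d) ℝ) :=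
    continuous_id
  refine measurable_pi_lambda _ fun j => ?_
  simp only [minNormSolution, Matrix.inv_def, Ring.inverse_eq_inv', Matrix.mul_smul, smul_mulVec,
    Pi.smul_apply, smul_eq_mul]
  refine Measurable.mul (Continuous.measurable ?_).inv (Continuous.measurable ?_)
  · fun_prop
  · refine continuous_pi_iff.1 (?_ : Continuous fun C : Fin m → Fin d → ℝ =>
      ((Matrix.of C)ᵀ * (Matrix.of C * (Matrix.of C)ᵀ).adjugate) *ᵥ Pi.single 0 1) j
    fun_prop

instance (D d : ℕ) : IsProbabilityMeasure (gaussMatrix D d) := by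
  unfold gaussMatrix; infer_instance

lemma measurePreserving_cons_gaussMatrix (n d : ℕ) :
    MeasurePreserving
      (fun p : (Fin n → Fin d → ℝ) × (Fin d → ℝ) => (Fin.cons p.2 p.1 : Fin (n + 1) → Fin d → ℝ))
      ((gaussMatrix n d).prod (Measure.pi fun _ : Fin d => gaussianReal 0 1))
      (gaussMatrix (n + 1) d) := by
  have h := (measurePreserving_piFinSuccAbove
    (fun _ : Fin (n + 1) => Measure.pi fun _ : Fin d => gaussianReal 0 1) 0).symm
  convert! h.comp Measure.measurePreserving_swap using 1
  funext p
  exact (Fin.insertNth_zero' p.2 p.1).symm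

lemma ae_mulVec_ne_zero {k d : ℕ} (hk : 0 < k) {N : Matrix (Fin k) (Fin d) ℝ} (hN : N * Nᵀ = 1) :
    ∀ᵐ x ∂(Measure.pi fun _ : Fin d => gaussianReal 0 1), N *ᵥ x ≠ 0 := by
  have := nullSingletonClass_gaussianReal (μ := 0) (v := 1) one_ne_zero
  have h0 := Measure.pi_hyperplane (fun _ : Fin k => gaussianReal 0 1) ⟨0, hk⟩ (0 : ℝ)
  have h1 := (measurePreserving_mulVec_pi_gaussianReal hN).quasiMeasurePreserving.ae
    (compl_mem_ae_iff.2 h0)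
  filter_upwards [h1] with x hx hx0
  exact hx (congrFun hx0 _)

/-- A Gaussian matrix with at most as many rows as columns has almost surely full row rank. -/
lemma ae_det_mul_transpose_ne_zero {m d : ℕ} (hm : m ≤ d) :
    ∀ᵐ C ∂(gaussMatrix m d), (Matrix.of C * (Matrix.of C)ᵀ).det ≠ 0 := by
  induction m with
  | zero => simp
  | succ n ih =>
    have hmeas : MeasurableSet {C : Fin (n + 1) → Fin d → ℝ |
        (Matrix.of C * (Matrix.of C)ᵀ).det ≠ 0} := by
      have h1 : Continuous fun C : Fin (n + 1) → Fin d → ℝ =>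
        (Matrix.of C : Matrix (Fin (n + 1)) (Fin d) ℝ) := continuous_id
      exact (isOpen_ne_fun (by fun_prop) continuous_const).measurableSet
    have hcons := measurePreserving_cons_gaussMatrix n d
    rw [← hcons.map_eq, ae_map_iff hcons.aemeasurable hmeas]
    refine (Measure.ae_prod_iff_ae_ae (hcons.measurable hmeas)).2 ?_
    filter_upwards [ih (by omega)] with R hR
    have hR : LinearIndependent ℝ R := det_mul_transpose_ne_zero_iff.1 hR
    obtain ⟨N, hN, hNR, -⟩ := exists_orthonormal_rows_of_orthogonal hR
    filter_upwards [ae_mulVec_ne_zero (by omega) hN] with x hx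
    refine det_mul_transpose_ne_zero_iff.2 (linearIndependent_finCons.2 ⟨hR, fun hxR => hx ?_⟩)
    have hle : Submodule.span ℝ (Set.range R) ≤ LinearMap.ker N.mulVecLin := by
      rw [Submodule.span_le]
      rintro _ ⟨i, rfl⟩
      exact hNR i
    exact hle hxR

/-- The expected squared norm of the minimum-norm solution of `C w = e₀`, `C` Gaussian. -/
lemma lintegral_sum_sq_minNormSolution {n d : ℕ} (h : n + 2 < d) :
    ∫⁻ C, ENNReal.ofReal (∑ j, minNormSolution (Matrix.of C) j ^ 2) ∂(gaussMatrix (n + 1) d) =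
      ENNReal.ofReal (1 / ((d : ℝ) - n - 2)) := by
  have hcons := measurePreserving_cons_gaussMatrix n d
  have hdet := hcons.quasiMeasurePreserving.ae (ae_det_mul_transpose_ne_zero (d := d) (by omega))
  have hmeas : Measurable fun C : Fin (n + 1) → Fin d → ℝ =>
      ENNReal.ofReal (∑ j, minNormSolution (Matrix.of C) j ^ 2) := by fun_prop
  rw [← hcons.lintegral_comp hmeas]
  refine (lintegral_prod _ (hmeas.comp hcons.measurable).aemeasurable).trans ?_
  have hinner : ∀ᵐ R ∂(gaussMatrix n d),
      ∫⁻ x, ENNReal.ofReal (∑ j, minNormSolution (Matrix.of (Fin.cons x R)) j ^ 2)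
        ∂(Measure.pi fun _ : Fin d => gaussianReal 0 1) =
      ENNReal.ofReal (1 / ((d : ℝ) - n - 2)) := by
    filter_upwards [Measure.ae_ae_of_ae_prod hdet, ae_det_mul_transpose_ne_zero (d := d) (m := n)
      (by omega)] with R hRx hR
    obtain ⟨N, hN, hNR, hN'⟩ :=
      exists_orthonormal_rows_of_orthogonal (det_mul_transpose_ne_zero_iff.1 hR)
    have hNmeas : Measurable fun y : Fin (d - n) → ℝ => ENNReal.ofReal (∑ a, y a ^ 2)⁻¹ := by
      fun_prop
    have hχ := (measurePreserving_mulVec_pi_gaussianReal hN).lintegral_comp hNmeas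
    rw [lintegral_inv_sum_sq_gaussianReal (by omega), Nat.cast_sub (by omega)] at hχ
    rw [← hχ]
    refine lintegral_congr_ae (hRx.mono fun x hx => congrArg ENNReal.ofReal ?_)
    exact sum_sq_minNormSolution hx hNR hN'
  exact (lintegral_congr_ae hinner).trans (by simp)

theorem stmt6 (D d de : ℕ) (hD : 0 < D) (hd : 0 < d) (hde : 0 < de)
    (h1 : de ≤ d) (h2 : d ≤ D) (h3 : 1 < d - de)
    (U : Matrix (Fin D) (Fin de) ℝ) (hU : U.transpose * U = 1)
    (zstar : Fin de → ℝ) (hz : zstar ≠ 0)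
    (y2 : (Fin D → Fin d → ℝ) → (Fin d → ℝ))
    (hy2 : ∀ A : Fin D → Fin d → ℝ,
      IsUnit ((U.transpose * Matrix.of A) * (U.transpose * Matrix.of A).transpose) →
      y2 A = ((U.transpose * Matrix.of A).transpose *
        ((U.transpose * Matrix.of A) * (U.transpose * Matrix.of A).transpose)⁻¹).mulVec zstar) :
    ∫ A, (∑ i, (y2 A) i ^ 2) ∂(gaussMatrix D d)
      = (∑ i, (U.mulVec zstar) i ^ 2) / ((d : ℝ) - (de : ℝ) - 1) := by
  obtain ⟨n, rfl⟩ : ∃ n, de = n + 1 := ⟨de - 1, by omega⟩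
  obtain ⟨O, s, hO, hOz, hs⟩ := exists_orthogonal_transpose_mulVec_eq hz
  have hO' : O * Oᵀ = 1 := mul_eq_one_comm.1 hO
  have hM : (Oᵀ * Uᵀ) * (Oᵀ * Uᵀ)ᵀ = 1 := by
    rw [transpose_mul, transpose_transpose, transpose_transpose, Matrix.mul_assoc,
      ← Matrix.mul_assoc Uᵀ, hU, Matrix.one_mul, hO]
  have hT := measurePreserving_mul_gaussMatrix d hM
  have hUz : ∑ i, (U *ᵥ zstar) i ^ 2 = s ^ 2 := by
    rw [hs]
    simpa [dotProduct, mulVec] using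
      sum_sq_vecMul_of_mul_transpose_eq_one (M := Uᵀ) (by simpa using hU) zstar
  have hy : ∀ᵐ A ∂(gaussMatrix D d), ∑ i, y2 A i ^ 2 =
      s ^ 2 * ∑ j, minNormSolution (Oᵀ * Uᵀ * Matrix.of A) j ^ 2 := by
    filter_upwards [hT.quasiMeasurePreserving.ae (ae_det_mul_transpose_ne_zero h1)] with A hA
    change ((Oᵀ * Uᵀ * Matrix.of A) * (Oᵀ * Uᵀ * Matrix.of A)ᵀ).det ≠ 0 at hA
    set C := Oᵀ * Uᵀ * Matrix.of A with hC
    have hB : Uᵀ * Matrix.of A = O * C := by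
      rw [hC, Matrix.mul_assoc Oᵀ, ← Matrix.mul_assoc O, hO', Matrix.one_mul]
    clear_value C
    have hinv : (O * (C * Cᵀ) * Oᵀ) * (O * (C * Cᵀ)⁻¹ * Oᵀ) = 1 := by
      calc _ = O * ((C * Cᵀ) * ((Oᵀ * O) * (C * Cᵀ)⁻¹)) * Oᵀ := by simp only [Matrix.mul_assoc]
        _ = 1 := by rw [hO, Matrix.one_mul, Matrix.mul_nonsing_inv _ hA.isUnit, Matrix.mul_one, hO']
    have hBB : (O * C) * (O * C)ᵀ = O * (C * Cᵀ) * Oᵀ := by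
      simp only [transpose_mul, Matrix.mul_assoc]
    have hyA := hy2 A (by
      rw [hB, hBB]
      exact IsUnit.of_mul_eq_one _ hinv)
    have hyC : y2 A = s • minNormSolution C := by
      rw [hyA, hB, hBB, Matrix.inv_eq_right_inv hinv, minNormSolution, ← mulVec_smul, ← hOz,
        mulVec_mulVec]
      congr 1
      calc _ = Cᵀ * ((Oᵀ * O) * ((C * Cᵀ)⁻¹ * Oᵀ)) := by
            simp only [transpose_mul, Matrix.mul_assoc]
        _ = _ := by rw [hO, Matrix.one_mul, ← Matrix.mul_assoc]
    simp [hyC, mul_pow, Finset.mul_sum]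
  have hmeas : Measurable fun C : Fin (n + 1) → Fin d → ℝ =>
      ∑ j, minNormSolution (Matrix.of C) j ^ 2 := by fun_prop
  have hlint := hT.lintegral_comp hmeas.ennreal_ofReal
  rw [lintegral_sum_sq_minNormSolution (by omega)] at hlint
  have hpos : (0 : ℝ) < (d : ℝ) - n - 2 := by
    have : ((n + 3 : ℕ) : ℝ) ≤ d := by exact_mod_cast (by omega : n + 3 ≤ d)
    push_cast at this
    linarith
  have hint := integral_eq_lintegral_of_nonneg_ae (μ := gaussMatrix D d)
    (f := fun A => ∑ j, minNormSolution (Oᵀ * Uᵀ * Matrix.of A) j ^ 2)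
    (.of_forall fun A => Finset.sum_nonneg fun _ _ => sq_nonneg _)
    (hmeas.comp hT.measurable).aestronglyMeasurable
  rw [integral_congr_ae hy, integral_const_mul, hUz, hint]
  refine (congrArg (fun r => s ^ 2 * ENNReal.toReal r) hlint).trans ?_
  rw [ENNReal.toReal_ofReal (by positivity), mul_one_div]
  push_cast
  congr 1
  ring
end
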